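/- arXiv:1311.5184 — 3 statements merged into one kernel-verified Lean document; each statement's English description precedes it below -/
import Mathlib

section
/- Let X and Y be independent random variables, each exponentially distributed with rate 1, and let λ > 0 and c > 0 be real constants. Then the expectation E[max(λ − c·(X/Y), 0)] = λ − c·ln(1 + λ/c). -/
open MeasureTheory ProbabilityTheory

lemma wf_exp_integral (g : ℝ → ℝ) :
    ∫ y, g y ∂(expMeasure 1) = ∫ y in Set.Ioi (0:ℝ), Real.exp (-y) * g y := by
  have hm : Measurable (gammaPDF 1 1) := (measurable_gammaPDFReal 1 1).ennreal_ofReal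
  rw [expMeasure, gammaMeasure, integral_withDensity_eq_integral_toReal_smul hm
    (Filter.Eventually.of_forall fun x => by simp [gammaPDF]), ← integral_Ici_eq_integral_Ioi,
    ← integral_indicator measurableSet_Ici]
  congr 1
  ext y
  by_cases hy : 0 ≤ y
  · have := Real.exp_pos (-y)
    simp [gammaPDF, gammaPDFReal, hy, this.le]
  · simp [gammaPDF, gammaPDFReal, hy]

lemma wf_exp_pos : ∀ᵐ y ∂(expMeasure 1), 0 < y := by
  have := isProbabilityMeasure_expMeasure (r := 1) one_pos
  have h : expMeasure 1 (Set.Iic 0) = 0 := by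
    rw [← ofReal_cdf, cdf_expMeasure_eq one_pos]; simp
  rw [ae_iff]
  convert h using 2
  ext y; simp

lemma wf_prob (v : ℝ) (hv : 0 ≤ v) :
    ((expMeasure 1).prod (expMeasure 1)).real {p : ℝ × ℝ | p.1 ≤ v * p.2} = 1 - 1 / (1 + v) := by
  have := isProbabilityMeasure_expMeasure (r := 1) one_pos
  have hs : MeasurableSet {p : ℝ × ℝ | p.1 ≤ v * p.2} :=
    measurableSet_le (by fun_prop) (by fun_prop)
  have h1 : ∀ y, expMeasure 1 ((fun x => (x, y)) ⁻¹' {p : ℝ × ℝ | p.1 ≤ v * p.2})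
      = ENNReal.ofReal (cdf (expMeasure 1) (v * y)) := by
    intro y
    rw [ofReal_cdf]; rfl
  rw [measureReal_def, Measure.prod_apply_symm hs]
  simp_rw [h1]
  rw [← integral_eq_lintegral_of_nonneg_ae (Filter.Eventually.of_forall fun y => cdf_nonneg _ _)
    (((monotone_cdf _).measurable.comp (by fun_prop)).aestronglyMeasurable), wf_exp_integral]
  have h2 : ∀ y ∈ Set.Ioi (0:ℝ), Real.exp (-y) * cdf (expMeasure 1) (v * y)
      = Real.exp ((-1) * y) - Real.exp ((-(1+v)) * y) := by
    intro y hy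
    rw [cdf_expMeasure_eq one_pos, if_pos (mul_nonneg hv (le_of_lt hy)), mul_sub, ← Real.exp_add]
    ring_nf
  rw [setIntegral_congr_fun measurableSet_Ioi h2, integral_sub
    (integrableOn_exp_mul_Ioi (by norm_num) 0) (integrableOn_exp_mul_Ioi (by linarith) 0),
    integral_exp_mul_Ioi (by norm_num), integral_exp_mul_Ioi (by linarith)]
  rw [mul_zero, mul_zero, Real.exp_zero, neg_div_neg_eq, neg_div_neg_eq, div_one]

/-- If `X` and `Y` are independent unit-rate exponential random variables and `λ, c > 0`,
then `E[max (λ - c·(X/Y)) 0] = λ - c·ln (1 + λ/c)`. -/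
theorem expectation_pos_part_waterfilling
    {Ω : Type*} [MeasurableSpace Ω] (P : Measure Ω) [IsProbabilityMeasure P]
    (X Y : Ω → ℝ) (hX : Measurable X) (hY : Measurable Y)
    (hXd : Measure.map X P = expMeasure 1) (hYd : Measure.map Y P = expMeasure 1)
    (hindep : IndepFun X Y P)
    (lam c : ℝ) (hlam : 0 < lam) (hc : 0 < c) :
    ∫ ω, max (lam - c * (X ω / Y ω)) 0 ∂P = lam - c * Real.log (1 + lam / c) := by
  have hXp : ∀ᵐ ω ∂P, 0 < X ω := ae_of_ae_map hX.aemeasurable (hXd ▸ wf_exp_pos)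
  have hYp : ∀ᵐ ω ∂P, 0 < Y ω := ae_of_ae_map hY.aemeasurable (hYd ▸ wf_exp_pos)
  have hm : Measurable fun ω => max (lam - c * (X ω / Y ω)) 0 := by fun_prop
  have hb : (fun ω => max (lam - c * (X ω / Y ω)) 0) ≤ᵐ[P] fun _ => lam := by
    filter_upwards [hXp, hYp] with ω h1 h2
    have : 0 < c * (X ω / Y ω) := by positivity
    exact max_le (by linarith) hlam.le
  have h0 : ∀ ω, 0 ≤ max (lam - c * (X ω / Y ω)) 0 := fun ω => le_max_right _ _
  have hi : Integrable (fun ω => max (lam - c * (X ω / Y ω)) 0) P := by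
    refine Integrable.of_bound hm.aestronglyMeasurable lam ?_
    filter_upwards [hb] with ω h
    rw [Real.norm_of_nonneg (h0 ω)]; exact h
  rw [hi.integral_eq_integral_Ioc_meas_le (Filter.Eventually.of_forall h0) hb]
  have hprod := hindep.map_prod_eq_prod_map_map hX.aemeasurable hY.aemeasurable
  rw [hXd, hYd] at hprod
  have key : ∀ t ∈ Set.Ioc 0 lam, P.real {ω | t ≤ max (lam - c * (X ω / Y ω)) 0}
      = 1 - c * (c + lam - t)⁻¹ := by
    intro t ht
    have hv : 0 ≤ (lam - t) / c := div_nonneg (by linarith [ht.2]) hc.le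
    have h3 := wf_prob _ hv
    rw [← hprod, map_measureReal_apply (by fun_prop)
      (measurableSet_le (by fun_prop) (by fun_prop))] at h3
    have h4 : c + lam - t ≠ 0 := by linarith [ht.2]
    have h5 : 1 - 1 / (1 + (lam - t) / c) = 1 - c * (c + lam - t)⁻¹ := by
      have : 1 + (lam - t) / c = (c + lam - t) / c := by field_simp; ring
      rw [this]; field_simp
    rw [← h5, ← h3]
    refine measureReal_congr ?_
    filter_upwards [hYp] with ω h2
    apply propext
    change t ≤ max (lam - c * (X ω / Y ω)) 0 ↔ X ω ≤ (lam - t) / c * Y ω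
    rw [le_max_iff, or_iff_left (not_le.2 ht.1), ← div_le_iff₀ h2, le_div_iff₀ hc]
    constructor <;> intro h <;> linarith
  rw [setIntegral_congr_fun measurableSet_Ioc key, ← intervalIntegral.integral_of_le hlam.le]
  have hint : IntervalIntegrable (fun t => c * (c + lam - t)⁻¹) volume 0 lam := by
    apply ContinuousOn.intervalIntegrable
    rw [Set.uIcc_of_le hlam.le]
    refine continuousOn_const.mul (ContinuousOn.inv₀ (by fun_prop) fun t ht => ?_)
    linarith [ht.2]
  rw [intervalIntegral.integral_sub (by simp) hint, intervalIntegral.integral_const_mul,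
    intervalIntegral.integral_comp_sub_left (fun x => x⁻¹) (c + lam),
    integral_inv_of_pos (by linarith) (by linarith)]
  have : (c + lam - 0) / (c + lam - lam) = 1 + lam / c := by
    rw [sub_zero, add_sub_cancel_right]; field_simp
  rw [this]; simp
end

section
/- (Theorem 2.) Let a > 0. For each integer K ≥ 2, let X₁, …, X_K be independent identically distributed nonnegative random variables with cumulative distribution function F(γ) = γ/(γ + a) for γ ≥ 0. Then for every real γ ≥ 0, lim_{K→∞} P[ (1/K)·min_{k=1,…,K} X_k ≤ (a/(K(K−1)))·γ ] = 1 − exp(−γ). -/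
open MeasureTheory ProbabilityTheory Filter Topology

/-- Theorem 2. Let `a > 0` and, for each `K`, let `X K 1, …, X K K` be i.i.d. nonnegative
random variables with CDF `γ ↦ γ/(γ + a)` for `γ ≥ 0`. Then for every `γ ≥ 0`,
`P[(1/K)·min_k X_k ≤ (a/(K(K-1)))·γ] → 1 - exp (-γ)` as `K → ∞`. -/
theorem limiting_cdf_of_normalized_scaled_min
    (a : ℝ) (ha : 0 < a)
    (Ω : ℕ → Type*) [∀ K, MeasurableSpace (Ω K)]
    (P : ∀ K, Measure (Ω K)) [∀ K, IsProbabilityMeasure (P K)]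
    (X : ∀ K, Fin K → Ω K → ℝ) (hX : ∀ K k, Measurable (X K k))
    (hnn : ∀ K k ω, 0 ≤ X K k ω)
    (hindep : ∀ K, iIndepFun (X K) (P K))
    (hcdf : ∀ K k, ∀ γ : ℝ, 0 ≤ γ →
      (P K) {ω | X K k ω ≤ γ} = ENNReal.ofReal (γ / (γ + a)))
    (γ : ℝ) (hγ : 0 ≤ γ) :
    Tendsto (fun K : ℕ =>
        (P K) {ω | (1 / (K : ℝ)) * (⨅ k, X K k ω)
          ≤ (a / ((K : ℝ) * ((K : ℝ) - 1))) * γ}) atTop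
      (𝓝 (ENNReal.ofReal (1 - Real.exp (-γ)))) := by
  rw [← tendsto_add_atTop_iff_nat 1]
  have hlim : Tendsto (fun n : ℕ => ENNReal.ofReal
      (1 - ((1 + γ / (n : ℝ)) ^ n * (1 + γ / (n : ℝ)))⁻¹)) atTop
      (𝓝 (ENNReal.ofReal (1 - Real.exp (-γ)))) := by
    apply ENNReal.tendsto_ofReal
    apply Tendsto.sub tendsto_const_nhds
    rw [Real.exp_neg]
    apply Tendsto.inv₀ _ (Real.exp_pos γ).ne'
    have h1 := Real.tendsto_one_add_div_pow_exp γ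
    have h2 : Tendsto (fun n : ℕ => 1 + γ / (n : ℝ)) atTop (𝓝 (1 + 0)) :=
      tendsto_const_nhds.add (tendsto_const_div_atTop_nhds_zero_nat γ)
    simpa using h1.mul h2
  refine hlim.congr' ?_
  filter_upwards [eventually_ge_atTop 1] with n hn
  have hn0 : (0 : ℝ) < n := by exact_mod_cast hn
  set t : ℝ := a * γ / n with ht
  have ht0 : 0 ≤ t := by positivity
  have hset : {ω | (1 / ((n + 1 : ℕ) : ℝ)) * (⨅ k, X (n + 1) k ω)
      ≤ (a / (((n + 1 : ℕ) : ℝ) * (((n + 1 : ℕ) : ℝ) - 1))) * γ}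
      = (⋂ k ∈ (Finset.univ : Finset (Fin (n + 1))), X (n + 1) k ⁻¹' Set.Ioi t)ᶜ := by
    ext ω
    have e1 : (a / (((n + 1 : ℕ) : ℝ) * (((n + 1 : ℕ) : ℝ) - 1))) * γ
        = (1 / ((n + 1 : ℕ) : ℝ)) * t := by
      push_cast
      rw [ht, add_sub_cancel_right]
      field_simp
    have hpos : (0 : ℝ) < 1 / ((n + 1 : ℕ) : ℝ) := by positivity
    simp only [Set.mem_setOf_eq, e1, Set.mem_compl_iff, Set.mem_iInter, Finset.mem_univ,
      Set.mem_preimage, Set.mem_Ioi, forall_true_left, not_forall, not_lt]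
    rw [mul_le_mul_iff_right₀ hpos]
    constructor
    · intro h
      obtain ⟨k, hk⟩ := exists_eq_ciInf_of_finite (f := fun k => X (n + 1) k ω)
      exact ⟨k, hk.trans_le h⟩
    · rintro ⟨k, hk⟩
      exact (ciInf_le (Set.finite_range _).bddBelow k).trans hk
  have hk : ∀ k, (P (n + 1)) (X (n + 1) k ⁻¹' Set.Ioi t) = ENNReal.ofReal ((1 + γ / n)⁻¹) := by
    intro k
    have e : X (n + 1) k ⁻¹' Set.Ioi t = {ω | X (n + 1) k ω ≤ t}ᶜ := by
      ext ω; simp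
    rw [e, prob_compl_eq_one_sub (measurableSet_le (hX _ k) measurable_const), hcdf _ k t ht0,
      ← ENNReal.ofReal_one, ← ENNReal.ofReal_sub _ (by positivity)]
    congr 1
    have : 0 < t + a := by positivity
    have h3 : (0 : ℝ) < n + γ := by positivity
    have h4 : t + a = a * (1 + γ / n) := by rw [ht]; ring
    have h5 : 0 < 1 + γ / n := by positivity
    rw [h4, ht]
    field_simp
    ring
  rw [hset, prob_compl_eq_one_sub
    (Finset.measurableSet_biInter _ fun k _ => hX _ k measurableSet_Ioi),
    (hindep (n + 1)).measure_inter_preimage_eq_mul Finset.univ (fun _ _ => measurableSet_Ioi)]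
  simp only [hk, Finset.prod_const, Finset.card_univ, Fintype.card_fin]
  rw [← ENNReal.ofReal_pow (by positivity), ← ENNReal.ofReal_one,
    ← ENNReal.ofReal_sub _ (by positivity), inv_pow, pow_succ]
end

section
/- Let a₁ > 0 and a₂ > 0, and let X and Y be independent random variables with densities a₁·(x + a₁)^{-2} and a₂·(x + a₂)^{-2} on (0,∞), respectively. Then for every γ > 0, P[ (1/X + 1/Y)^{-1} ≤ γ ] = 1 − (1/2)·(1 + γ/a₁)^{-1}·(1 + γ/a₂)^{-1}·h(z), where z = (1 + (1/a₁ + 1/a₂)γ) / ((1 + γ/a₁)(1 + γ/a₂)) ∈ (0,1) and h(z) = 2·(z + (1 − z)·ln(1 − z))/z² is the elementary closed form of the Gaussian hypergeometric function ₂F₁(1, 1; 3; z). -/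
open MeasureTheory ProbabilityTheory

lemma dh_lint (f G : ℝ → ℝ) (a L : ℝ) (hd : ∀ x ∈ Set.Ici a, HasDerivAt G (f x) x)
    (hp : ∀ x ∈ Set.Ioi a, 0 ≤ f x) (hL : Filter.Tendsto G Filter.atTop (nhds L)) :
    ∫⁻ x in Set.Ioi a, ENNReal.ofReal (f x) = ENNReal.ofReal (L - G a) ∧ 0 ≤ L - G a := by
  have hi := integrableOn_Ioi_deriv_of_nonneg' hd hp hL
  have he := integral_Ioi_of_hasDerivAt_of_nonneg' hd hp hL
  have hae : ∀ᵐ x ∂(volume.restrict (Set.Ioi a)), 0 ≤ f x :=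
    (ae_restrict_iff' measurableSet_Ioi).2 (Filter.Eventually.of_forall hp)
  constructor
  · rw [← he, ofReal_integral_eq_lintegral_ofReal hi hae]
  · rw [← he]
    exact integral_nonneg_of_ae hae

lemma dh_tail (a t : ℝ) (ha : 0 < a) (ht : 0 ≤ t) :
    (volume.withDensity (fun x =>
      ENNReal.ofReal (Set.indicator (Set.Ioi 0) (fun x => a * ((x + a) ^ 2)⁻¹) x))) (Set.Ioi t)
      = ENNReal.ofReal (a / (t + a)) := by
  rw [withDensity_apply _ measurableSet_Ioi]
  have h := (dh_lint (fun x => a * ((x + a) ^ 2)⁻¹) (fun x => -a * (x + a)⁻¹) t 0 ?_ ?_ ?_).1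
  · have e : (0:ℝ) - -a * (t + a)⁻¹ = a / (t + a) := by rw [div_eq_mul_inv]; ring
    rw [e] at h
    rw [← h]
    refine setLIntegral_congr_fun measurableSet_Ioi ?_
    intro x hx
    have : x ∈ Set.Ioi (0:ℝ) := lt_of_le_of_lt ht hx
    simp only [Set.indicator_of_mem this]
  · intro x hx
    have hx' : x + a ≠ 0 := by have : t ≤ x := hx; exact (by linarith : 0 < x + a).ne'
    have := (((hasDerivAt_id x).add_const a).inv hx').const_mul (-a)
    refine HasDerivAt.congr_deriv (f := fun x => -a * (x + a)⁻¹) this ?_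
    simp only [id]
    field_simp
  · intro x hx; positivity
  · have : Filter.Tendsto (fun x : ℝ => x + a) Filter.atTop Filter.atTop :=
      Filter.tendsto_atTop_add_const_right _ _ Filter.tendsto_id
    simpa using (tendsto_inv_atTop_zero.comp this).const_mul (-a)

lemma dh_J (a₁ a₂ γ : ℝ) (ha₁ : 0 < a₁) (ha₂ : 0 < a₂) (hγ : 0 < γ) (D : ℝ)
    (hD : D = a₁ * a₂ + γ * (a₁ + a₂)) :
    let J := a₁ * a₂ * (1 / D + γ ^ 2 / D ^ 2 *
      (Real.log (γ ^ 2) - Real.log (γ + a₁) - Real.log (γ + a₂)))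
    ∫⁻ x in Set.Ioi γ, ENNReal.ofReal (a₁ * ((x + a₁) ^ 2)⁻¹ * (a₂ / (γ * x / (x - γ) + a₂)))
      = ENNReal.ofReal J ∧ 0 ≤ J := by
  intro J
  have hDp : 0 < D := by rw [hD]; positivity
  have key : ∀ x, γ ≤ x → 0 < (γ + a₂) * x - a₂ * γ := by
    intro x hx
    nlinarith [mul_le_mul_of_nonneg_left hx ha₂.le, mul_pos hγ hγ]
  have h := dh_lint (fun x => a₁ * a₂ * ((x - γ) / ((x + a₁) ^ 2 * ((γ + a₂) * x - a₂ * γ))))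
    (fun x => a₁ * a₂ * (-((γ + a₁) / D) * (x + a₁)⁻¹ + γ ^ 2 / D ^ 2 *
      (Real.log (x + a₁) - Real.log ((γ + a₂) * x - a₂ * γ)))) γ
      (a₁ * a₂ * (-((γ + a₁) / D) * 0 + γ ^ 2 / D ^ 2 * Real.log (1 / (γ + a₂)))) ?_ ?_ ?_
  · have e : a₁ * a₂ * (-((γ + a₁) / D) * 0 + γ ^ 2 / D ^ 2 * Real.log (1 / (γ + a₂)))
      - a₁ * a₂ * (-((γ + a₁) / D) * (γ + a₁)⁻¹ + γ ^ 2 / D ^ 2 *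
      (Real.log (γ + a₁) - Real.log ((γ + a₂) * γ - a₂ * γ))) = J := by
      have h1 : (γ + a₂) * γ - a₂ * γ = γ ^ 2 := by ring
      have h2 : (γ + a₁) / D * (γ + a₁)⁻¹ = 1 / D := by field_simp
      rw [h1, one_div, Real.log_inv, neg_mul, neg_mul, h2]
      simp only [J]
      ring
    simp only [e] at h
    refine ⟨?_, h.2⟩
    rw [← h.1]
    refine setLIntegral_congr_fun measurableSet_Ioi ?_
    intro x hx
    have hx' : γ < x := hx
    have h0 : 0 < x := hγ.trans hx'
    have h1 : 0 < x - γ := sub_pos.2 hx'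
    have h2 := key x hx'.le
    have h3 : γ * x / (x - γ) + a₂ = ((γ + a₂) * x - a₂ * γ) / (x - γ) := by
      field_simp; ring
    simp only [h3]
    congr 1
    field_simp
  · intro x hx
    have hx' : γ ≤ x := hx
    have h1 : x + a₁ ≠ 0 := (by linarith : 0 < x + a₁).ne'
    have h2 := (key x hx').ne'
    have d1 := (hasDerivAt_id x).add_const a₁
    have d2 := ((hasDerivAt_id x).const_mul (γ + a₂)).sub_const (a₂ * γ)
    have := (((d1.inv h1).const_mul (-((γ + a₁) / D))).add
      (((d1.log h1).sub (d2.log h2)).const_mul (γ ^ 2 / D ^ 2))).const_mul (a₁ * a₂)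
    refine HasDerivAt.congr_deriv this ?_
    simp only [id, mul_one]
    have h3 : D ≠ 0 := hDp.ne'
    generalize hE : (γ + a₂) * x - a₂ * γ = E at h2 ⊢
    field_simp
    rw [hD, ← hE]
    ring
  · intro x hx
    have hx' : γ < x := hx
    have h2 := key x hx'.le
    have h1 : 0 < x - γ := sub_pos.2 hx'
    positivity
  · have t1 : Filter.Tendsto (fun x : ℝ => x + a₁) Filter.atTop Filter.atTop :=
      Filter.tendsto_atTop_add_const_right _ _ Filter.tendsto_id
    have t2 : Filter.Tendsto (fun x : ℝ => (x + a₁)⁻¹) Filter.atTop (nhds 0) :=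
      tendsto_inv_atTop_zero.comp t1
    have hB : 0 < γ + a₂ := by positivity
    have t3 : Filter.Tendsto (fun x : ℝ => (γ + a₂) * x - a₂ * γ) Filter.atTop Filter.atTop :=
      Filter.tendsto_atTop_add_const_right _ _ (Filter.tendsto_id.const_mul_atTop hB)
    have t4 : Filter.Tendsto (fun x : ℝ => 1 / (γ + a₂) + (a₁ + a₂ * γ / (γ + a₂)) /
        ((γ + a₂) * x - a₂ * γ)) Filter.atTop (nhds (1 / (γ + a₂))) := by
      simpa using (t3.const_div_atTop (a₁ + a₂ * γ / (γ + a₂))).const_add (1 / (γ + a₂))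
    have t5 := t4.log (by positivity)
    refine Filter.Tendsto.const_mul _ ((t2.const_mul _).add (Filter.Tendsto.const_mul _ ?_))
    refine t5.congr' ?_
    filter_upwards [Filter.eventually_ge_atTop γ] with x hx
    have h2 := key x hx
    have h1 : x + a₁ ≠ 0 := (by linarith : 0 < x + a₁).ne'
    have h3 := h2.ne'
    rw [← Real.log_div h1 h3]
    congr 1
    generalize hE : (γ + a₂) * x - a₂ * γ = E at h3 ⊢
    field_simp
    rw [← hE]
    ring



/-- Dual-hop closed-form CDF. If `X` and `Y` are independent with densities
`a₁(x+a₁)⁻²` and `a₂(x+a₂)⁻²` on `(0,∞)`, then for `γ > 0`,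
`P[(1/X + 1/Y)⁻¹ ≤ γ] = 1 - (1/2)(1+γ/a₁)⁻¹(1+γ/a₂)⁻¹ h(z)` where
`z = (1+(1/a₁+1/a₂)γ)/((1+γ/a₁)(1+γ/a₂)) ∈ (0,1)` and
`h z = 2(z + (1-z)ln(1-z))/z²` is the closed form of `₂F₁(1,1;3;z)`. -/
theorem dual_hop_e2e_snr_cdf
    {Ω : Type*} [MeasurableSpace Ω] (P : Measure Ω) [IsProbabilityMeasure P]
    (a₁ a₂ : ℝ) (ha₁ : 0 < a₁) (ha₂ : 0 < a₂)
    (X Y : Ω → ℝ) (hX : Measurable X) (hY : Measurable Y)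
    (hXd : Measure.map X P = volume.withDensity (fun x =>
      ENNReal.ofReal (Set.indicator (Set.Ioi 0) (fun x => a₁ * ((x + a₁) ^ 2)⁻¹) x)))
    (hYd : Measure.map Y P = volume.withDensity (fun x =>
      ENNReal.ofReal (Set.indicator (Set.Ioi 0) (fun x => a₂ * ((x + a₂) ^ 2)⁻¹) x)))
    (hindep : IndepFun X Y P)
    (γ : ℝ) (hγ : 0 < γ) :
    (1 + (1 / a₁ + 1 / a₂) * γ) / ((1 + γ / a₁) * (1 + γ / a₂)) ∈ Set.Ioo (0 : ℝ) 1 ∧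
    P {ω | ((X ω)⁻¹ + (Y ω)⁻¹)⁻¹ ≤ γ}
      = ENNReal.ofReal (1 - (1 / 2) * (1 + γ / a₁)⁻¹ * (1 + γ / a₂)⁻¹ *
          (let z := (1 + (1 / a₁ + 1 / a₂) * γ) / ((1 + γ / a₁) * (1 + γ / a₂));
            2 * (z + (1 - z) * Real.log (1 - z)) / z ^ 2)) := by
  have hA : 0 < γ + a₁ := by positivity
  have hB : 0 < γ + a₂ := by positivity
  obtain ⟨D, hD⟩ : ∃ D, D = a₁ * a₂ + γ * (a₁ + a₂) := ⟨_, rfl⟩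
  have hDp : 0 < D := by rw [hD]; positivity
  have hz : (1 + (1 / a₁ + 1 / a₂) * γ) / ((1 + γ / a₁) * (1 + γ / a₂))
      = D / ((γ + a₁) * (γ + a₂)) := by
    rw [hD]; field_simp; ring
  have h1z : 1 - D / ((γ + a₁) * (γ + a₂)) = γ ^ 2 / ((γ + a₁) * (γ + a₂)) := by
    rw [hD]; field_simp; ring
  refine ⟨?_, ?_⟩
  · rw [hz]
    refine ⟨by positivity, ?_⟩
    have : 0 < γ ^ 2 / ((γ + a₁) * (γ + a₂)) := by positivity
    linarith
  obtain ⟨hJ, hJ0⟩ := dh_J a₁ a₂ γ ha₁ ha₂ hγ D hD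
  simp only [hz, h1z]
  have hfin : (1 / 2) * (1 + γ / a₁)⁻¹ * (1 + γ / a₂)⁻¹ *
      (2 * (D / ((γ + a₁) * (γ + a₂)) + γ ^ 2 / ((γ + a₁) * (γ + a₂)) *
        Real.log (γ ^ 2 / ((γ + a₁) * (γ + a₂)))) / (D / ((γ + a₁) * (γ + a₂))) ^ 2)
      = a₁ * a₂ * (1 / D + γ ^ 2 / D ^ 2 *
      (Real.log (γ ^ 2) - Real.log (γ + a₁) - Real.log (γ + a₂))) := by
    rw [Real.log_div (by positivity) (by positivity), Real.log_mul hA.ne' hB.ne', ← sub_sub]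
    generalize Real.log (γ ^ 2) - Real.log (γ + a₁) - Real.log (γ + a₂) = l
    have e1 : 1 + γ / a₁ = (γ + a₁) / a₁ := by field_simp; ring
    have e2 : 1 + γ / a₂ = (γ + a₂) / a₂ := by field_simp; ring
    rw [e1, e2]
    field_simp
  rw [hfin, ENNReal.ofReal_sub _ hJ0, ← hJ, ENNReal.ofReal_one]
  let S : Set (ℝ × ℝ) := {p | γ < (p.1⁻¹ + p.2⁻¹)⁻¹}
  have hS : MeasurableSet S := measurableSet_lt measurable_const (by fun_prop)
  have hc : {ω | ((X ω)⁻¹ + (Y ω)⁻¹)⁻¹ ≤ γ} = ((fun ω => (X ω, Y ω)) ⁻¹' S)ᶜ := by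
    ext ω; simp [S]
  have hm : Measurable (fun ω => (X ω, Y ω)) := hX.prodMk hY
  rw [hc, prob_compl_eq_one_sub (hm hS)]
  congr 1
  rw [← Measure.map_apply hm hS,
    (indepFun_iff_map_prod_eq_prod_map_map hX.aemeasurable hY.aemeasurable).1 hindep]
  have : IsProbabilityMeasure (Measure.map Y P) := Measure.isProbabilityMeasure_map hY.aemeasurable
  rw [Measure.prod_apply hS]
  have hYneg : Measure.map Y P (Set.Iic 0) = 0 := by
    rw [hYd, withDensity_apply _ measurableSet_Iic]
    rw [setLIntegral_congr_fun (g := fun _ => 0) measurableSet_Iic]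
    · simp
    · intro x hx
      have : x ∉ Set.Ioi (0:ℝ) := fun h => not_lt.2 (show x ≤ 0 from hx) h
      simp only [Set.indicator_of_notMem this, ENNReal.ofReal_zero]
  have hsec : ∀ x, 0 < x → Measure.map Y P (Prod.mk x ⁻¹' S) =
      if γ < x then ENNReal.ofReal (a₂ / (γ * x / (x - γ) + a₂)) else 0 := by
    intro x hx
    have hiff : ∀ y, 0 < y → ((x, y) ∈ S ↔ γ * (x + y) < x * y) := by
      intro y hy
      have : (x⁻¹ + y⁻¹)⁻¹ = x * y / (x + y) := by field_simp; try ring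
      simp only [S, Set.mem_ofPred_eq, this]
      rw [lt_div_iff₀ (by positivity)]
    split_ifs with hxg
    · have h1 : 0 < x - γ := sub_pos.2 hxg
      rw [← dh_tail a₂ (γ * x / (x - γ)) ha₂ (by positivity), ← hYd]
      refine measure_congr ?_
      have hae : ∀ᵐ y ∂(Measure.map Y P), 0 < y := by
        rw [ae_iff]; simpa [Set.Iic] using hYneg
      filter_upwards [hae] with y hy
      refine propext ?_
      change (x, y) ∈ S ↔ γ * x / (x - γ) < y
      rw [hiff y hy, div_lt_iff₀ h1]
      constructor <;> intro h <;> linarith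
    · refine measure_mono_null ?_ hYneg
      intro y hy
      by_contra hy0
      have hy1 : 0 < y := not_le.1 hy0
      have := (hiff y hy1).1 hy
      nlinarith [mul_le_mul_of_nonneg_right (not_lt.1 hxg) hy1.le, mul_pos hγ hx]
  have hmeas : Measurable (fun x => Measure.map Y P (Prod.mk x ⁻¹' S)) :=
    measurable_measure_prodMk_left hS
  have hdm : Measurable (fun x => ENNReal.ofReal
      (Set.indicator (Set.Ioi 0) (fun x => a₁ * ((x + a₁) ^ 2)⁻¹) x)) :=
    ((Measurable.indicator (by fun_prop) measurableSet_Ioi)).ennreal_ofReal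
  rw [hXd, lintegral_withDensity_eq_lintegral_mul _ hdm hmeas,
    ← lintegral_indicator measurableSet_Ioi]
  refine lintegral_congr ?_
  intro x
  simp only [Pi.mul_apply]
  by_cases hx : 0 < x
  · rw [hsec x hx, Set.indicator_of_mem (show x ∈ Set.Ioi (0:ℝ) from hx)]
    by_cases hxg : γ < x
    · rw [if_pos hxg, Set.indicator_of_mem (show x ∈ Set.Ioi γ from hxg),
        ← ENNReal.ofReal_mul (by positivity)]
    · rw [if_neg hxg, Set.indicator_of_notMem (show x ∉ Set.Ioi γ from hxg), mul_zero]
  · rw [Set.indicator_of_notMem (show x ∉ Set.Ioi (0:ℝ) from hx),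
      Set.indicator_of_notMem (show x ∉ Set.Ioi γ from fun h => hx (hγ.trans h))]
    simp
end
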